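/- Weighted p-Poincaré inequality for weak-Harnack weights (the content of the application to supersolutions of the p-Laplace equation): let n ≥ 1, 2n/(n+1) < p < ∞, Ω ⊂ ℝ^n a bounded domain, and w a weight on Ω. Suppose there exist β > 1 with β(n−p) < n(p−1) and a constant C_1 > 0 such that for every cube Q with 4Q ⊂ Ω, (|Q|^{-1}∫_Q w(x)^β dx)^{1/β} ≤ C_1 · ess inf_{x∈Q} w(x) (the weak Harnack estimate satisfied by nonnegative weak supersolutions of the p-Laplace equation in Ω). Then there is a constant C = C(n, p, β, C_1) > 0 such that for every cube Q_0 with 4Q_0 ⊂ Ω and every u ∈ Lip(Q_0), ∫_{Q_0} |u(x) − u_{Q_0}|^p w(x) dx ≤ C · l(Q_0)^p ∫_{Q_0} |∇u(x)|^p w(x) dx. -/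

import Mathlib

open MeasureTheory ENNReal NNReal Set

noncomputable section

/-- Euclidean space `ℝ^n`. -/
abbrev Rn (n : ℕ) := EuclideanSpace ℝ (Fin n)

/-- The half-open cube `Q(z, r)` with midpoint `z` and side length `2r`. -/
def CubeC {n : ℕ} (z : Rn n) (r : ℝ) : Set (Rn n) :=
  {y | ∀ i, z i - r ≤ y i ∧ y i < z i + r}

lemma CubeC_eq_preimage {n : ℕ} (z : Rn n) (r : ℝ) :
    CubeC z r = (WithLp.ofLp : Rn n → (Fin n → ℝ)) ⁻¹'
      (Set.univ.pi fun i => Ico (z i - r) (z i + r)) := by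
  ext y
  simp [CubeC, Set.mem_pi]

lemma measurableSet_CubeC {n : ℕ} (z : Rn n) (r : ℝ) : MeasurableSet (CubeC z r) := by
  rw [CubeC_eq_preimage]
  exact (PiLp.volume_preserving_ofLp (Fin n)).measurable
    (MeasurableSet.univ_pi fun _ => measurableSet_Ico)

lemma volume_CubeC {n : ℕ} (z : Rn n) (r : ℝ) :
    volume (CubeC z r) = ENNReal.ofReal (2 * r) ^ n := by
  rw [CubeC_eq_preimage, (PiLp.volume_preserving_ofLp (Fin n)).measure_preimage
    (MeasurableSet.univ_pi fun _ => measurableSet_Ico).nullMeasurableSet, Real.volume_pi_Ico]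
  simp only [Finset.prod_const, Finset.card_univ, Fintype.card_fin,
    show ∀ i, z i + r - (z i - r) = 2 * r from fun i => by ring]

lemma volume_CubeC_ne_zero {n : ℕ} (z : Rn n) {r : ℝ} (hr : 0 < r) :
    volume (CubeC z r) ≠ 0 := by
  rw [volume_CubeC]
  exact pow_ne_zero _ (by simpa using hr)

lemma volume_CubeC_ne_top {n : ℕ} (z : Rn n) (r : ℝ) : volume (CubeC z r) ≠ ∞ := by
  rw [volume_CubeC]
  exact ENNReal.pow_ne_top ENNReal.ofReal_ne_top

/-- Almost every point of a half-open cube is an interior point. -/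
lemma ae_mem_interior_CubeC {n : ℕ} (z : Rn n) (r : ℝ) :
    ∀ᵐ x ∂(volume.restrict (CubeC z r)), x ∈ interior (CubeC z r) := by
  have h : (Set.univ.pi fun i => Ico (z i - r) (z i + r)) ≤ᵐ[volume]
      (Set.univ.pi fun i => Ioo (z i - r) (z i + r)) :=
    (Measure.univ_pi_Ico_ae_eq_Icc.trans Measure.univ_pi_Ioo_ae_eq_Icc.symm).le
  have h' := (PiLp.volume_preserving_ofLp (Fin n)).quasiMeasurePreserving.ae h
  rw [ae_restrict_iff' (measurableSet_CubeC z r)]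
  filter_upwards [h'] with x hx hxQ
  rw [CubeC_eq_preimage] at hxQ ⊢
  refine mem_interior.2 ⟨_, preimage_mono (Set.pi_mono fun i _ => Ioo_subset_Ico_self), ?_, hx hxQ⟩
  exact (isOpen_set_pi Set.finite_univ fun i _ => isOpen_Ioo).preimage
    (PiLp.continuous_ofLp 2 _)

lemma norm_le_of_forall_abs_le {n : ℕ} {x : Rn n} {b : ℝ} (hx : ∀ i, |x i| ≤ b) :
    ‖x‖ ≤ n * b := by
  have h : ‖x‖ ≤ ∑ i, ‖x i‖ := by
    conv_lhs => rw [← (EuclideanSpace.basisFun (Fin n) ℝ).sum_repr x]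
    refine (norm_sum_le _ _).trans (Finset.sum_le_sum fun i _ => ?_)
    simp [norm_smul]
  refine h.trans ((Finset.sum_le_sum fun i _ => hx i).trans ?_)
  simp

section Jensen

variable {α : Type*} [MeasurableSpace α]

lemma lintegral_rpow_le_lintegral_rpow {μ : Measure α} [IsProbabilityMeasure μ] {f : α → ℝ≥0∞}
    (hf : AEMeasurable f μ) {p : ℝ} (hp : 1 ≤ p) :
    (∫⁻ x, f x ∂μ) ^ p ≤ ∫⁻ x, f x ^ p ∂μ := by
  have h := eLpNorm'_le_eLpNorm'_of_exponent_le zero_lt_one hp μ hf.aestronglyMeasurable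
  have hp0 : 0 < p := by linarith
  simp only [eLpNorm', enorm_eq_self, ENNReal.rpow_one, div_one] at h
  calc _ ≤ ((∫⁻ x, f x ^ p ∂μ) ^ (1 / p)) ^ p := by gcongr
    _ = _ := by rw [← ENNReal.rpow_mul, one_div_mul_cancel hp0.ne', ENNReal.rpow_one]

lemma average_rpow_le_average_rpow {μ : Measure α} {s : Set α} (h0 : μ s ≠ 0) (h1 : μ s ≠ ∞)
    {f : α → ℝ≥0∞} (hf : AEMeasurable f (μ.restrict s)) {p : ℝ} (hp : 1 ≤ p) :
    ((μ s)⁻¹ * ∫⁻ x in s, f x ∂μ) ^ p ≤ (μ s)⁻¹ * ∫⁻ x in s, f x ^ p ∂μ := by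
  have : IsProbabilityMeasure ((μ s)⁻¹ • μ.restrict s) :=
    ⟨by simp [ENNReal.inv_mul_cancel h0 h1]⟩
  simpa using lintegral_rpow_le_lintegral_rpow (hf.smul_measure (μ s)⁻¹) hp

lemma tsum_half_pow_add_one : ∑' j : ℕ, (2⁻¹ : ℝ≥0∞) ^ (j + 1) = 1 := by
  rw [ENNReal.tsum_geometric_add_one, ENNReal.one_sub_inv_two, inv_inv]
  exact ENNReal.inv_mul_cancel (by simp) (by simp)

lemma tsum_half_pow_mul_rpow_le (b : ℕ → ℝ≥0∞) {p : ℝ} (hp : 1 ≤ p) :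
    (∑' j, 2⁻¹ ^ (j + 1) * b j) ^ p ≤ ∑' j, 2⁻¹ ^ (j + 1) * b j ^ p := by
  let μ : Measure ℕ := Measure.sum fun j => ((2⁻¹ : ℝ≥0∞) ^ (j + 1)) • Measure.dirac j
  have hμ : ∀ f : ℕ → ℝ≥0∞, ∫⁻ j, f j ∂μ = ∑' j, 2⁻¹ ^ (j + 1) * f j := fun f => by
    simp [μ, lintegral_sum_measure]
  have : IsProbabilityMeasure μ := ⟨by
    rw [← lintegral_one, hμ]
    simp only [mul_one]
    exact tsum_half_pow_add_one⟩
  have h := lintegral_rpow_le_lintegral_rpow (μ := μ) (f := b) (by fun_prop) hp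
  rwa [hμ, hμ] at h

end Jensen

section Homothety

variable {n : ℕ}

lemma hasFDerivAt_smul_sub_add (e : Rn n) (s : ℝ) (y : Rn n) :
    HasFDerivAt (fun y : Rn n => s • (y - e) + e) (s • ContinuousLinearMap.id ℝ (Rn n)) y :=
  (((hasFDerivAt_id y).sub_const e).const_smul s).add_const e

lemma injective_smul_sub_add (e : Rn n) {s : ℝ} (hs : 0 < s) :
    Function.Injective (fun y : Rn n => s • (y - e) + e) := fun a b h => by
  simpa [hs.ne'] using h

lemma det_smul_id (s : ℝ) : (s • ContinuousLinearMap.id ℝ (Rn n)).det = s ^ n := by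
  simp [ContinuousLinearMap.det]

lemma lintegral_image_smul_sub_add (e : Rn n) {s : ℝ} (hs : 0 < s) {A : Set (Rn n)}
    (hA : MeasurableSet A) (F : Rn n → ℝ≥0∞) :
    ∫⁻ x in (fun y : Rn n => s • (y - e) + e) '' A, F x =
      ENNReal.ofReal s ^ n * ∫⁻ y in A, F (s • (y - e) + e) := by
  rw [lintegral_image_eq_lintegral_abs_det_fderiv_mul volume hA
    (fun y _ => (hasFDerivAt_smul_sub_add e s y).hasFDerivWithinAt)
    (injective_smul_sub_add e hs).injOn F, lintegral_const_mul']
  · simp only [det_smul_id]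
    rw [abs_of_pos (by positivity), ENNReal.ofReal_pow hs.le]
  · exact ENNReal.ofReal_ne_top

lemma integral_image_smul_sub_add (e : Rn n) {s : ℝ} (hs : 0 < s) {A : Set (Rn n)}
    (hA : MeasurableSet A) (F : Rn n → ℝ) :
    ∫ x in (fun y : Rn n => s • (y - e) + e) '' A, F x =
      s ^ n * ∫ y in A, F (s • (y - e) + e) := by
  rw [integral_image_eq_integral_abs_det_fderiv_smul volume hA
    (fun y _ => (hasFDerivAt_smul_sub_add e s y).hasFDerivWithinAt)
    (injective_smul_sub_add e hs).injOn F]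
  simp only [det_smul_id, smul_eq_mul]
  rw [abs_of_pos (by positivity), integral_const_mul]

lemma quasiMeasurePreserving_smul_sub_add (e : Rn n) {s : ℝ} (hs : 0 < s) :
    Measure.QuasiMeasurePreserving (fun y : Rn n => s • (y - e) + e) volume volume := by
  refine ⟨by fun_prop, Measure.AbsolutelyContinuous.mk fun N hN hN0 => ?_⟩
  have hm : Measurable (fun y : Rn n => s • (y - e) + e) := by fun_prop
  rw [Measure.map_apply hm hN]
  have h := lintegral_image_smul_sub_add e hs (hm hN) 1
  have h0 : ∫⁻ x in (fun y : Rn n => s • (y - e) + e) ''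
      ((fun y : Rn n => s • (y - e) + e) ⁻¹' N), (1 : Rn n → ℝ≥0∞) x = 0 := by
    simpa using measure_mono_null (image_preimage_subset _ _) hN0
  rw [h0] at h
  simpa [hs.not_ge] using h.symm

end Homothety

section Poincare

variable {n : ℕ}

/-- The variation of a Lipschitz function on a segment, if almost every point of the segment is a
point of differentiability. -/
lemma ofReal_abs_sub_le_lintegral_segment {v : Rn n → ℝ} {L : ℝ≥0} (hv : LipschitzWith L v)
    (e y : Rn n)
    (hd : ∀ᵐ s ∂(volume.restrict (Ioc (1 / 2 : ℝ) 1)), DifferentiableAt ℝ v (s • (y - e) + e)) :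
    ENNReal.ofReal |v y - v ((1 / 2 : ℝ) • (y - e) + e)| ≤
      ∫⁻ s in Ioc (1 / 2 : ℝ) 1,
        ENNReal.ofReal ‖fderiv ℝ v (s • (y - e) + e)‖ * ENNReal.ofReal ‖y - e‖ := by
  set h : ℝ → ℝ := fun s => v (s • (y - e) + e) with hh
  have hline : LipschitzWith ‖y - e‖₊ fun s : ℝ => s • (y - e) + e :=
    LipschitzWith.of_dist_le_mul fun a b => by
      rw [dist_add_right, dist_eq_norm, ← sub_smul, norm_smul, mul_comm, Real.dist_eq]
      rfl
  have hac : AbsolutelyContinuousOnInterval h (1 / 2) 1 :=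
    ((hv.comp hline).lipschitzOnWith).absolutelyContinuousOnInterval
  have hftc := hac.integral_deriv_eq_sub
  have h1 : h 1 = v y := by simp [hh]
  rw [h1] at hftc
  rw [show v ((1 / 2 : ℝ) • (y - e) + e) = h (1 / 2) from rfl, ← hftc,
    intervalIntegral.integral_of_le (by norm_num), ← Real.norm_eq_abs, ofReal_norm]
  refine (enorm_integral_le_lintegral_enorm _).trans (lintegral_mono_ae ?_)
  filter_upwards [hd] with s hs
  have hder : HasDerivAt h (fderiv ℝ v (s • (y - e) + e) (y - e)) s := by
    have hl : HasDerivAt (fun s : ℝ => s • (y - e) + e) (y - e) s := by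
      simpa using ((hasDerivAt_id s).smul_const (y - e)).add_const e
    exact hs.hasFDerivAt.comp_hasDerivAt s hl
  rw [hder.deriv, ← ofReal_norm, ← ENNReal.ofReal_mul (norm_nonneg _)]
  exact ENNReal.ofReal_le_ofReal (ContinuousLinearMap.le_opNorm _ _)

lemma ae_ae_differentiableAt_segment {v : Rn n → ℝ} {L : ℝ≥0} (hv : LipschitzWith L v)
    (e : Rn n) :
    ∀ᵐ y : Rn n, ∀ᵐ s ∂(volume.restrict (Ioc (1 / 2 : ℝ) 1)),
      DifferentiableAt ℝ v (s • (y - e) + e) := by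
  have hmeas : MeasurableSet {q : Rn n × ℝ | DifferentiableAt ℝ v (q.2 • (q.1 - e) + e)} :=
    (measurableSet_of_differentiableAt ℝ v).preimage
      (f := fun q : Rn n × ℝ => q.2 • (q.1 - e) + e) (by fun_prop)
  rw [Measure.ae_ae_comm hmeas]
  filter_upwards [ae_restrict_mem measurableSet_Ioc] with s hs
  exact (quasiMeasurePreserving_smul_sub_add e (by linarith [hs.1])).ae hv.ae_differentiableAt

lemma smul_sub_add_mem_CubeC {c e y : Rn n} {ρ s : ℝ} (he : ∀ i, |e i - c i| ≤ ρ)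
    (hs0 : 0 < s) (hs1 : s ≤ 1) (hy : y ∈ CubeC c ρ) : s • (y - e) + e ∈ CubeC c ρ := by
  intro i
  obtain ⟨h1, h2⟩ := hy i
  obtain ⟨h3, h4⟩ := abs_le.1 (he i)
  simp only [PiLp.add_apply, PiLp.smul_apply, PiLp.sub_apply, smul_eq_mul]
  constructor <;> nlinarith

lemma image_half_smul_sub_add_CubeC {c c' : Rn n} {ρ : ℝ} :
    (fun y : Rn n => (1 / 2 : ℝ) • (y - ((2 : ℝ) • c' - c)) + ((2 : ℝ) • c' - c)) '' CubeC c ρ =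
      CubeC c' (ρ / 2) := by
  ext x
  constructor
  · rintro ⟨y, hy, rfl⟩ i
    have := hy i
    simp only [PiLp.add_apply, PiLp.smul_apply, PiLp.sub_apply, smul_eq_mul]
    constructor <;> linarith
  · intro hx
    refine ⟨(2 : ℝ) • x - ((2 : ℝ) • c' - c), fun i => ?_, ?_⟩
    · have := hx i
      simp only [PiLp.smul_apply, PiLp.sub_apply, smul_eq_mul]
      constructor <;> linarith
    · ext i
      simp only [PiLp.add_apply, PiLp.smul_apply, PiLp.sub_apply, smul_eq_mul]
      ring

lemma lintegral_abs_sub_le {v : Rn n → ℝ} {L : ℝ≥0} (hv : LipschitzWith L v)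
    {c e : Rn n} {ρ : ℝ} (he : ∀ i, |e i - c i| ≤ ρ) :
    ∫⁻ y in CubeC c ρ, ENNReal.ofReal |v y - v ((1 / 2 : ℝ) • (y - e) + e)| ≤
      ENNReal.ofReal (2 ^ n * (n * (2 * ρ))) *
        ∫⁻ y in CubeC c ρ, ENNReal.ofReal ‖fderiv ℝ v y‖ := by
  have hQ := measurableSet_CubeC c ρ
  set g : Rn n → ℝ≥0∞ := fun y => ENNReal.ofReal ‖fderiv ℝ v y‖ with hg
  have hgm : Measurable g := (measurable_fderiv ℝ v).norm.ennreal_ofReal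
  have hbound : ∀ y ∈ CubeC c ρ, ‖y - e‖ ≤ n * (2 * ρ) := fun y hy =>
    norm_le_of_forall_abs_le fun i => by
      have h1 := hy i
      have h2 := abs_le.1 (he i)
      rw [PiLp.sub_apply, abs_le]
      constructor <;> linarith
  have hint : ∀ s ∈ Ioc (1 / 2 : ℝ) 1, ∫⁻ y in CubeC c ρ, g (s • (y - e) + e) ≤
      2 ^ n * ∫⁻ y in CubeC c ρ, g y := fun s hs => by
    have hs0 : 0 < s := by linarith [hs.1]
    have him := lintegral_image_smul_sub_add e hs0 hQ g
    have hsub : (fun y : Rn n => s • (y - e) + e) '' CubeC c ρ ⊆ CubeC c ρ := by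
      rintro _ ⟨y, hy, rfl⟩
      exact smul_sub_add_mem_CubeC he hs0 hs.2 hy
    have h2s : 1 ≤ 2 * ENNReal.ofReal s := by
      rw [← ENNReal.ofReal_ofNat 2, ← ENNReal.ofReal_mul (by norm_num), ← ENNReal.ofReal_one]
      exact ENNReal.ofReal_le_ofReal (by linarith [hs.1])
    calc ∫⁻ y in CubeC c ρ, g (s • (y - e) + e)
        ≤ (2 * ENNReal.ofReal s) ^ n * ∫⁻ y in CubeC c ρ, g (s • (y - e) + e) :=
          le_mul_of_one_le_left' (one_le_pow₀ h2s)
      _ = 2 ^ n * ∫⁻ x in (fun y : Rn n => s • (y - e) + e) '' CubeC c ρ, g x := by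
          rw [him, mul_pow, mul_assoc]
      _ ≤ _ := by gcongr
  calc ∫⁻ y in CubeC c ρ, ENNReal.ofReal |v y - v ((1 / 2 : ℝ) • (y - e) + e)|
      ≤ ∫⁻ y in CubeC c ρ, ∫⁻ s in Ioc (1 / 2 : ℝ) 1,
          g (s • (y - e) + e) * ENNReal.ofReal (n * (2 * ρ)) := by
        refine lintegral_mono_ae ?_
        filter_upwards [ae_restrict_of_ae (ae_ae_differentiableAt_segment hv e),
          ae_restrict_mem hQ] with y hy hyQ
        refine (ofReal_abs_sub_le_lintegral_segment hv e y hy).trans (lintegral_mono fun s => ?_)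
        have := hbound y hyQ
        dsimp only [hg]
        gcongr
    _ = ∫⁻ s in Ioc (1 / 2 : ℝ) 1, ∫⁻ y in CubeC c ρ,
          g (s • (y - e) + e) * ENNReal.ofReal (n * (2 * ρ)) := by
        refine lintegral_lintegral_swap (Measurable.aemeasurable ?_)
        exact (hgm.comp (by fun_prop)).mul_const _
    _ ≤ ∫⁻ s in Ioc (1 / 2 : ℝ) 1,
          (2 ^ n * ∫⁻ y in CubeC c ρ, g y) * ENNReal.ofReal (n * (2 * ρ)) := by
        refine setLIntegral_mono' measurableSet_Ioc fun s hs => ?_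
        rw [lintegral_mul_const' _ _ ENNReal.ofReal_ne_top]
        gcongr
        exact hint s hs
    _ ≤ (2 ^ n * ∫⁻ y in CubeC c ρ, g y) * ENNReal.ofReal (n * (2 * ρ)) := by
        rw [setLIntegral_const, Real.volume_Ioc]
        refine mul_le_of_le_one_right' ?_
        rw [← ENNReal.ofReal_one]
        exact ENNReal.ofReal_le_ofReal (by norm_num)
    _ = _ := by
        rw [ENNReal.ofReal_mul (p := 2 ^ n) (by positivity), ENNReal.ofReal_pow (by norm_num),
          ENNReal.ofReal_ofNat]
        ring

lemma integrableOn_CubeC {v : Rn n → ℝ} (hv : Continuous v) (c : Rn n) (ρ : ℝ) :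
    IntegrableOn v (CubeC c ρ) := by
  refine (hv.continuousOn.integrableOn_compact (isCompact_closedBall c (n * ρ))).mono_set
    fun y hy => ?_
  rw [Metric.mem_closedBall, dist_eq_norm]
  refine norm_le_of_forall_abs_le fun i => ?_
  have := hy i
  rw [PiLp.sub_apply, abs_le]
  constructor <;> linarith

/-- The averages of a Lipschitz function over a cube and over a subcube of half the side length
differ by at most a multiple of the average of the gradient. -/
lemma edist_average_le {v : Rn n → ℝ} {L : ℝ≥0} (hv : LipschitzWith L v)
    {c c' : Rn n} {ρ : ℝ} (hρ : 0 < ρ) (hc : ∀ i, |c' i - c i| ≤ ρ / 2) :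
    edist (⨍ y in CubeC c ρ, v y) (⨍ y in CubeC c' (ρ / 2), v y) ≤
      ENNReal.ofReal (2 ^ n * (n * (2 * ρ))) *
        ((volume (CubeC c ρ))⁻¹ * ∫⁻ y in CubeC c ρ, ENNReal.ofReal ‖fderiv ℝ v y‖) := by
  set e : Rn n := (2 : ℝ) • c' - c with he_def
  have he : ∀ i, |e i - c i| ≤ ρ := fun i => by
    have := abs_le.1 (hc i)
    rw [he_def, PiLp.sub_apply, PiLp.smul_apply, smul_eq_mul, abs_le]
    constructor <;> linarith
  have hQ := measurableSet_CubeC c ρ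
  have hvol : ∀ (z : Rn n) {t : ℝ}, 0 < t → volume.real (CubeC z t) = (2 * t) ^ n :=
    fun z t ht => by
      rw [Measure.real, volume_CubeC, ENNReal.toReal_pow, ENNReal.toReal_ofReal (by positivity)]
  have hhalf : ⨍ y in CubeC c' (ρ / 2), v y =
      ⨍ y in CubeC c ρ, v ((1 / 2 : ℝ) • (y - e) + e) := by
    rw [setAverage_eq, setAverage_eq, hvol _ hρ, hvol _ (half_pos hρ),
      ← image_half_smul_sub_add_CubeC (c := c), integral_image_smul_sub_add _ (by norm_num) hQ,
      smul_eq_mul, smul_eq_mul, ← mul_assoc]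
    congr 1
    rw [show 2 * ρ = 2 * (2 * (ρ / 2)) by ring, mul_pow 2 (2 * (ρ / 2))]
    field_simp
    rw [← mul_pow]
    norm_num
  have hv1 := integrableOn_CubeC hv.continuous c ρ
  have hv2 := integrableOn_CubeC (v := fun y => v ((1 / 2 : ℝ) • (y - e) + e))
    (hv.continuous.comp (by fun_prop)) c ρ
  rw [hhalf, edist_eq_enorm_sub, setAverage_eq, setAverage_eq, ← smul_sub, ← integral_sub hv1 hv2,
    enorm_smul, mul_left_comm]
  have hvi : ‖(volume.real (CubeC c ρ))⁻¹‖ₑ = (volume (CubeC c ρ))⁻¹ := by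
    rw [enorm_inv (by rw [hvol _ hρ]; positivity), Real.enorm_eq_ofReal measureReal_nonneg,
      ofReal_measureReal (volume_CubeC_ne_top c ρ)]
  rw [hvi]
  gcongr
  refine (enorm_integral_le_lintegral_enorm _).trans (le_trans (le_of_eq ?_)
    (lintegral_abs_sub_le hv he))
  simp_rw [← ofReal_norm, Real.norm_eq_abs]

end Poincare

section Dyadic

variable {n : ℕ}

/-- The index of the dyadic subcube of generation `j` of `CubeC z r` that contains `x`. -/
def dyadicIndex (z : Rn n) (r : ℝ) (j : ℕ) (x : Rn n) : Fin n → ℤ :=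
  fun i => ⌊(x i - (z i - r)) / (2 * (r / 2 ^ j))⌋

/-- The midpoint of the dyadic subcube of generation `j` of `CubeC z r` with index `k`. -/
def dyadicCenter (z : Rn n) (r : ℝ) (j : ℕ) (k : Fin n → ℤ) : Rn n :=
  WithLp.toLp 2 fun i => z i - r + 2 * (r / 2 ^ j) * (k i + 1 / 2)

/-- The dyadic subcube of generation `j` of `CubeC z r` with index `k`. -/
def dyadicCube (z : Rn n) (r : ℝ) (j : ℕ) (k : Fin n → ℤ) : Set (Rn n) :=
  CubeC (dyadicCenter z r j k) (r / 2 ^ j)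

lemma measurable_dyadicIndex (z : Rn n) (r : ℝ) (j : ℕ) : Measurable (dyadicIndex z r j) := by
  unfold dyadicIndex
  fun_prop

lemma mem_dyadicCube_iff {z : Rn n} {r : ℝ} (hr : 0 < r) {j : ℕ} {k : Fin n → ℤ} {x : Rn n} :
    x ∈ dyadicCube z r j k ↔ dyadicIndex z r j x = k := by
  have hρ : 0 < 2 * (r / 2 ^ j) := by positivity
  rw [funext_iff]
  refine forall_congr' fun i => ?_
  simp only [dyadicIndex, dyadicCenter, Int.floor_eq_iff, le_div_iff₀ hρ, div_lt_iff₀ hρ]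
  refine and_congr ?_ ?_ <;> constructor <;> intro h <;> linarith

lemma CubeC_subset_CubeC {c z : Rn n} {ρ R : ℝ} (h : ∀ i, |c i - z i| ≤ R - ρ) :
    CubeC c ρ ⊆ CubeC z R := fun y hy i => by
  have h1 := hy i
  have h2 := abs_le.1 (h i)
  constructor <;> linarith

lemma abs_dyadicCenter_sub_le {z : Rn n} {r : ℝ} (hr : 0 < r) (j : ℕ) {x : Rn n}
    (hx : x ∈ CubeC z r) (i : Fin n) :
    |dyadicCenter z r j (dyadicIndex z r j x) i - z i| ≤ r - r / 2 ^ j := by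
  have hρ : 0 < r / 2 ^ j := by positivity
  obtain ⟨h1, h2⟩ := hx i
  have hk0 : 0 ≤ dyadicIndex z r j x i :=
    Int.floor_nonneg.2 (div_nonneg (by linarith) (by positivity))
  have hk1 : dyadicIndex z r j x i < (2 : ℤ) ^ j := by
    refine Int.floor_lt.2 ?_
    rw [div_lt_iff₀ (by positivity)]
    push_cast
    field_simp
    linarith
  have hk0' : (0 : ℝ) ≤ dyadicIndex z r j x i := by exact_mod_cast hk0
  have hk1' : (dyadicIndex z r j x i : ℝ) + 1 ≤ 2 ^ j := by exact_mod_cast hk1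
  have hr2 : r / 2 ^ j * 2 ^ j = r := by field_simp
  simp only [dyadicCenter]
  rw [abs_le]
  constructor <;> nlinarith

lemma dyadicCube_subset {z : Rn n} {r : ℝ} (hr : 0 < r) (j : ℕ) {x : Rn n}
    (hx : x ∈ CubeC z r) : dyadicCube z r j (dyadicIndex z r j x) ⊆ CubeC z r :=
  CubeC_subset_CubeC (abs_dyadicCenter_sub_le hr j hx)

lemma dyadicCube_zero {z : Rn n} {r : ℝ} (hr : 0 < r) {x : Rn n} (hx : x ∈ CubeC z r) :
    dyadicCube z r 0 (dyadicIndex z r 0 x) = CubeC z r := by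
  have h : dyadicCenter z r 0 (dyadicIndex z r 0 x) = z := by
    ext i
    have := abs_dyadicCenter_sub_le hr 0 hx i
    simp only [pow_zero, div_one, sub_self, abs_nonpos_iff] at this
    linarith
  rw [dyadicCube, h, pow_zero, div_one]

lemma abs_dyadicCenter_succ_sub_le {z : Rn n} {r : ℝ} (hr : 0 < r) (j : ℕ) (x : Rn n)
    (i : Fin n) :
    |dyadicCenter z r (j + 1) (dyadicIndex z r (j + 1) x) i -
      dyadicCenter z r j (dyadicIndex z r j x) i| ≤ r / 2 ^ j / 2 := by
  have hρ : 0 < r / 2 ^ j := by positivity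
  set X := (x i - (z i - r)) / (2 * (r / 2 ^ j)) with hX
  have e0 : dyadicIndex z r j x i = ⌊X⌋ := rfl
  have e1 : dyadicIndex z r (j + 1) x i = ⌊2 * X⌋ := by
    simp only [dyadicIndex, hX]
    congr 1
    field_simp
    ring
  have hr1 : r / 2 ^ (j + 1) = r / 2 ^ j / 2 := by rw [pow_succ]; field_simp
  have h1 : 2 * ⌊X⌋ ≤ ⌊2 * X⌋ := Int.le_floor.2 (by push_cast; linarith [Int.floor_le X])
  have h2 : ⌊2 * X⌋ < 2 * ⌊X⌋ + 2 :=
    Int.floor_lt.2 (by push_cast; linarith [Int.lt_floor_add_one X])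
  have h1' : 2 * (⌊X⌋ : ℝ) ≤ ⌊2 * X⌋ := by exact_mod_cast h1
  have h2' : (⌊2 * X⌋ : ℝ) ≤ 2 * ⌊X⌋ + 1 := by
    exact_mod_cast (by omega : ⌊2 * X⌋ ≤ 2 * ⌊X⌋ + 1)
  simp only [dyadicCenter]
  rw [e0, e1, hr1, abs_le]
  constructor <;> nlinarith

/-- The cube is the disjoint union of its dyadic subcubes of a given generation. -/
lemma biUnion_dyadicCube {z : Rn n} {r : ℝ} (hr : 0 < r) (j : ℕ) :
    ⋃ k ∈ dyadicIndex z r j '' CubeC z r, dyadicCube z r j k = CubeC z r := by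
  rw [biUnion_image]
  refine Subset.antisymm (iUnion₂_subset fun x hx => dyadicCube_subset hr j hx) fun x hx => ?_
  exact mem_biUnion hx ((mem_dyadicCube_iff hr).2 rfl)

lemma lintegral_CubeC_eq_tsum {z : Rn n} {r : ℝ} (hr : 0 < r) (j : ℕ) (F : Rn n → ℝ≥0∞) :
    ∫⁻ x in CubeC z r, F x =
      ∑' k : dyadicIndex z r j '' CubeC z r, ∫⁻ x in dyadicCube z r j k, F x := by
  conv_lhs => rw [← biUnion_dyadicCube hr j]
  refine lintegral_biUnion (to_countable _) (fun k _ => measurableSet_CubeC _ _) ?_ F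
  intro k _ l _ hkl
  refine disjoint_left.2 fun x hx hx' => hkl ?_
  rw [← (mem_dyadicCube_iff hr).1 hx, (mem_dyadicCube_iff hr).1 hx']

lemma tendsto_average_dyadicCube {v : Rn n → ℝ} {L : ℝ≥0} (hv : LipschitzWith L v)
    {z : Rn n} {r : ℝ} (hr : 0 < r) (x : Rn n) :
    Filter.Tendsto (fun j => ⨍ y in dyadicCube z r j (dyadicIndex z r j x), v y)
      Filter.atTop (nhds (v x)) := by
  have hlim : Filter.Tendsto (fun j : ℕ => L * (n * (2 * (r / 2 ^ j)))) Filter.atTop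
      (nhds (0 : ℝ)) := by
    have h : Filter.Tendsto (fun j : ℕ => L * (n * (2 * r)) * (1 / 2 : ℝ) ^ j) Filter.atTop
        (nhds (L * (n * (2 * r)) * 0)) :=
      (_root_.tendsto_pow_atTop_nhds_zero_of_lt_one (by norm_num) (by norm_num)).const_mul _
    rw [mul_zero] at h
    refine h.congr fun j => ?_
    rw [one_div, inv_pow]
    ring
  rw [tendsto_iff_dist_tendsto_zero]
  refine squeeze_zero (fun _ => dist_nonneg) (fun j => ?_) hlim
  have hρ : 0 < r / 2 ^ j := by positivity
  have hx := (mem_dyadicCube_iff hr).2 (rfl : dyadicIndex z r j x = _)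
  set Q := dyadicCube z r j (dyadicIndex z r j x) with hQ
  have hmem : (⨍ y in Q, v y) ∈ Metric.closedBall (v x) (L * (n * (2 * (r / 2 ^ j)))) := by
    refine (convex_closedBall _ _).set_average_mem Metric.isClosed_closedBall
      (volume_CubeC_ne_zero _ hρ) (volume_CubeC_ne_top _ _) ?_
      (integrableOn_CubeC hv.continuous _ _)
    filter_upwards [ae_restrict_mem (measurableSet_CubeC _ _)] with y hy
    refine (hv.dist_le_mul y x).trans ?_
    gcongr
    rw [dist_eq_norm]
    refine norm_le_of_forall_abs_le fun i => ?_
    have h1 := hx i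
    have h2 := hy i
    rw [PiLp.sub_apply, abs_le]
    constructor <;> linarith
  exact hmem

end Dyadic

section Weight

variable {n : ℕ}

lemma average_mul_lintegral_le {W h : Rn n → ℝ≥0∞} {β : ℝ} {K : ℝ≥0∞} (hβ : 1 < β)
    {c : Rn n} {ρ : ℝ} (hρ : 0 < ρ) (hW : AEMeasurable W (volume.restrict (CubeC c ρ)))
    (hh : Measurable h)
    (hHarnack : ((volume (CubeC c ρ))⁻¹ * ∫⁻ x in CubeC c ρ, W x ^ β) ^ (1 / β) ≤
      K * essInf W (volume.restrict (CubeC c ρ))) :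
    ((volume (CubeC c ρ))⁻¹ * ∫⁻ x in CubeC c ρ, h x) * ∫⁻ x in CubeC c ρ, W x ≤
      K * ∫⁻ x in CubeC c ρ, h x * W x := by
  set Q := CubeC c ρ
  have hβ0 : 0 < β := by linarith
  have hJ : (volume Q)⁻¹ * ∫⁻ x in Q, W x ≤
      ((volume Q)⁻¹ * ∫⁻ x in Q, W x ^ β) ^ (1 / β) := by
    rw [one_div, ENNReal.le_rpow_inv_iff hβ0]
    exact average_rpow_le_average_rpow (volume_CubeC_ne_zero _ hρ) (volume_CubeC_ne_top _ _) hW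
      hβ.le
  calc ((volume Q)⁻¹ * ∫⁻ x in Q, h x) * ∫⁻ x in Q, W x
      = (∫⁻ x in Q, h x) * ((volume Q)⁻¹ * ∫⁻ x in Q, W x) := by ring
    _ ≤ (∫⁻ x in Q, h x) * (K * essInf W (volume.restrict Q)) := by
        exact mul_le_mul_right (hJ.trans hHarnack) _
    _ = K * ∫⁻ x in Q, h x * essInf W (volume.restrict Q) := by
        rw [lintegral_mul_const _ hh]
        ring
    _ ≤ K * ∫⁻ x in Q, h x * W x := by
        refine mul_le_mul_right (lintegral_mono_ae ?_) _
        filter_upwards [ae_essInf_le (f := W) (μ := volume.restrict Q)] with x hx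
        gcongr

lemma lintegral_dyadic_average_mul_le {W h : Rn n → ℝ≥0∞} {β : ℝ} {K : ℝ≥0∞} (hβ : 1 < β)
    {z : Rn n} {r : ℝ} (hr : 0 < r) (hW : AEMeasurable W (volume.restrict (CubeC z r)))
    (hh : Measurable h)
    (hHarnack : ∀ (c : Rn n) (ρ : ℝ), 0 < ρ → CubeC c (4 * ρ) ⊆ CubeC z (4 * r) →
      ((volume (CubeC c ρ))⁻¹ * ∫⁻ x in CubeC c ρ, W x ^ β) ^ (1 / β) ≤
      K * essInf W (volume.restrict (CubeC c ρ))) (j : ℕ) :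
    ∫⁻ x in CubeC z r, ((volume (dyadicCube z r j (dyadicIndex z r j x)))⁻¹ *
        ∫⁻ y in dyadicCube z r j (dyadicIndex z r j x), h y) * W x ≤
      K * ∫⁻ x in CubeC z r, h x * W x := by
  have hρ : 0 < r / 2 ^ j := by positivity
  have hρr : r / 2 ^ j ≤ r := div_le_self hr.le (one_le_pow₀ (by norm_num))
  rw [lintegral_CubeC_eq_tsum hr j, lintegral_CubeC_eq_tsum hr j (fun x => h x * W x),
    ← ENNReal.tsum_mul_left]
  refine ENNReal.tsum_le_tsum ?_
  rintro ⟨_, x, hx, rfl⟩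
  set k := dyadicIndex z r j x
  have hWk : AEMeasurable W (volume.restrict (dyadicCube z r j k)) :=
    hW.mono_measure (Measure.restrict_mono_set _ (dyadicCube_subset hr j hx))
  calc ∫⁻ x in dyadicCube z r j k, ((volume (dyadicCube z r j (dyadicIndex z r j x)))⁻¹ *
        ∫⁻ y in dyadicCube z r j (dyadicIndex z r j x), h y) * W x
      = ∫⁻ x in dyadicCube z r j k, ((volume (dyadicCube z r j k))⁻¹ *
        ∫⁻ y in dyadicCube z r j k, h y) * W x := by
        refine setLIntegral_congr_fun (measurableSet_CubeC _ _) fun y hy => ?_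
        simp only [(mem_dyadicCube_iff hr).1 hy]
    _ = ((volume (dyadicCube z r j k))⁻¹ * ∫⁻ y in dyadicCube z r j k, h y) *
        ∫⁻ x in dyadicCube z r j k, W x := lintegral_const_mul'' _ hWk
    _ ≤ K * ∫⁻ x in dyadicCube z r j k, h x * W x := by
        refine average_mul_lintegral_le hβ hρ hWk hh (hHarnack _ _ hρ (CubeC_subset_CubeC ?_))
        intro i
        linarith [abs_dyadicCenter_sub_le hr j hx i]

lemma rpow_edist_average_le {v : Rn n → ℝ} {L : ℝ≥0} (hv : LipschitzWith L v) {p : ℝ}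
    (hp : 1 ≤ p) {z : Rn n} {r : ℝ} (hr : 0 < r) {x : Rn n} (hx : x ∈ CubeC z r) :
    edist (⨍ y in CubeC z r, v y) (v x) ^ p ≤
      ENNReal.ofReal (2 ^ (n + 1) * n * (2 * r)) ^ p *
        ∑' j : ℕ, 2⁻¹ ^ (j + 1) * ((volume (dyadicCube z r j (dyadicIndex z r j x)))⁻¹ *
          ∫⁻ y in dyadicCube z r j (dyadicIndex z r j x), ENNReal.ofReal ‖fderiv ℝ v y‖ ^ p) := by
  have hp0 : 0 ≤ p := by linarith
  set Q : ℕ → Set (Rn n) := fun j => dyadicCube z r j (dyadicIndex z r j x) with hQ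
  set g : Rn n → ℝ≥0∞ := fun y => ENNReal.ofReal ‖fderiv ℝ v y‖ with hg
  have hgm : Measurable g := (measurable_fderiv ℝ v).norm.ennreal_ofReal
  have hstep : ∀ j, edist (⨍ y in Q j, v y) (⨍ y in Q (j + 1), v y) ≤
      ENNReal.ofReal (2 ^ (n + 1) * n * (2 * r)) *
        (2⁻¹ ^ (j + 1) * ((volume (Q j))⁻¹ * ∫⁻ y in Q j, g y)) := fun j => by
    have h := edist_average_le hv (ρ := r / 2 ^ j) (by positivity)
      (abs_dyadicCenter_succ_sub_le (z := z) hr j x)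
    rw [show r / 2 ^ j / 2 = r / 2 ^ (j + 1) by rw [pow_succ]; field_simp] at h
    refine h.trans (le_of_eq ?_)
    rw [← mul_assoc (ENNReal.ofReal _) (2⁻¹ ^ (j + 1))]
    congr 1
    rw [← ENNReal.ofReal_ofNat 2, ← ENNReal.ofReal_inv_of_pos (by norm_num),
      ← ENNReal.ofReal_pow (by norm_num), ← ENNReal.ofReal_mul (by positivity)]
    congr 1
    rw [inv_pow]
    field_simp
    ring
  have htel := edist_le_tsum_of_edist_le_of_tendsto₀ _ hstep (tendsto_average_dyadicCube hv hr x)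
  rw [ENNReal.tsum_mul_left, hQ] at htel
  simp only [dyadicCube_zero hr hx] at htel
  refine (ENNReal.rpow_le_rpow htel hp0).trans ?_
  rw [ENNReal.mul_rpow_of_nonneg _ _ hp0]
  refine mul_le_mul_right ((tsum_half_pow_mul_rpow_le _ hp).trans ?_) _
  refine ENNReal.tsum_le_tsum fun j => mul_le_mul_right ?_ _
  exact average_rpow_le_average_rpow (volume_CubeC_ne_zero _ (by positivity))
    (volume_CubeC_ne_top _ _) hgm.aemeasurable hp

lemma lintegral_edist_average_rpow_mul_le {W : Rn n → ℝ≥0∞} {β : ℝ} {K : ℝ≥0∞} (hβ : 1 < β)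
    {z : Rn n} {r : ℝ} (hr : 0 < r) (hW : AEMeasurable W (volume.restrict (CubeC z r)))
    (hHarnack : ∀ (c : Rn n) (ρ : ℝ), 0 < ρ → CubeC c (4 * ρ) ⊆ CubeC z (4 * r) →
      ((volume (CubeC c ρ))⁻¹ * ∫⁻ x in CubeC c ρ, W x ^ β) ^ (1 / β) ≤
      K * essInf W (volume.restrict (CubeC c ρ)))
    {v : Rn n → ℝ} {L : ℝ≥0} (hv : LipschitzWith L v) {p : ℝ} (hp : 1 ≤ p) :
    ∫⁻ x in CubeC z r, edist (⨍ y in CubeC z r, v y) (v x) ^ p * W x ≤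
      ENNReal.ofReal (2 ^ (n + 1) * n * (2 * r)) ^ p *
        (K * ∫⁻ x in CubeC z r, ENNReal.ofReal ‖fderiv ℝ v x‖ ^ p * W x) := by
  set h : Rn n → ℝ≥0∞ := fun y => ENNReal.ofReal ‖fderiv ℝ v y‖ ^ p with hh
  have hhm : Measurable h := (measurable_fderiv ℝ v).norm.ennreal_ofReal.pow_const p
  set H : ℕ → Rn n → ℝ≥0∞ := fun j x =>
    (volume (dyadicCube z r j (dyadicIndex z r j x)))⁻¹ *
      ∫⁻ y in dyadicCube z r j (dyadicIndex z r j x), h y with hH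
  have hHm : ∀ j, Measurable (H j) := fun j =>
    (measurable_of_countable fun k : Fin n → ℤ => (volume (dyadicCube z r j k))⁻¹ *
      ∫⁻ y in dyadicCube z r j k, h y).comp (measurable_dyadicIndex z r j)
  set A := ENNReal.ofReal (2 ^ (n + 1) * n * (2 * r)) ^ p with hA
  have hA_top : A ≠ ∞ := ENNReal.rpow_ne_top_of_nonneg (by linarith) ENNReal.ofReal_ne_top
  calc ∫⁻ x in CubeC z r, edist (⨍ y in CubeC z r, v y) (v x) ^ p * W x
      ≤ ∫⁻ x in CubeC z r, A * ∑' j : ℕ, 2⁻¹ ^ (j + 1) * (H j x * W x) := by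
        refine setLIntegral_mono' (measurableSet_CubeC z r) fun x hx => ?_
        refine (mul_le_mul_left (rpow_edist_average_le hv hp hr hx) _).trans (le_of_eq ?_)
        rw [mul_assoc, ← ENNReal.tsum_mul_right]
        simp only [mul_assoc, hH, hA, hh]
    _ = A * ∑' j : ℕ, 2⁻¹ ^ (j + 1) * ∫⁻ x in CubeC z r, H j x * W x := by
        have hHW : ∀ j, AEMeasurable (fun x => H j x * W x) (volume.restrict (CubeC z r)) :=
          fun j => (hHm j).aemeasurable.mul hW
        rw [lintegral_const_mul' _ _ hA_top, lintegral_tsum fun j => (hHW j).const_mul _]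
        congr 2
        ext j
        exact lintegral_const_mul'' _ (hHW j)
    _ ≤ A * ∑' j : ℕ, 2⁻¹ ^ (j + 1) * (K * ∫⁻ x in CubeC z r, h x * W x) := by
        gcongr with j
        exact lintegral_dyadic_average_mul_le hβ hr hW hhm hHarnack j
    _ = A * (K * ∫⁻ x in CubeC z r, h x * W x) := by
        rw [ENNReal.tsum_mul_right, tsum_half_pow_add_one, one_mul]

end Weight

/-- weighted `p`-Poincaré inequality for weights satisfying the weak
Harnack estimate; the content of the application to nonnegative weak supersolutions of the
`p`-Laplace equation: let `2n/(n+1) < p < ∞`, `Ω ⊆ ℝ^n` a bounded domain, and `w` a weight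
on `Ω` satisfying `(⨍_Q w^β)^{1/β} ≤ C₁ ess inf_Q w` for some `β > 1` with
`β(n−p) < n(p−1)` on every cube `Q` with `4Q ⊆ Ω`. Then there is `C = C(n, p, β, C₁) > 0`
such that for every cube `Q₀` with `4Q₀ ⊆ Ω` and every Lipschitz `u` on `Q₀`,
`∫_{Q₀} |u − u_{Q₀}|^p w dx ≤ C l(Q₀)^p ∫_{Q₀} |∇u|^p w dx`. -/
theorem weighted_poincare_for_weak_harnack_weights
    (n : ℕ) (hn : 0 < n) (p β C₁ : ℝ) (hp : 2 * n / (n + 1) < p) (hβ : 1 < β)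
    (hβ2 : β * (n - p) < n * (p - 1)) (hC₁ : 0 < C₁) :
    ∃ C : ℝ, 0 < C ∧
      ∀ Ω : Set (Rn n), IsOpen Ω → IsConnected Ω → Bornology.IsBounded Ω →
      ∀ w : Rn n → ℝ, LocallyIntegrableOn w Ω volume →
        (∀ᵐ x ∂(volume : Measure (Rn n)), x ∈ Ω → 0 < w x) →
        (∀ (z : Rn n) (r : ℝ), 0 < r → CubeC z (4 * r) ⊆ Ω →
          ((volume (CubeC z r))⁻¹ * ∫⁻ x in CubeC z r, ENNReal.ofReal (w x) ^ β) ^ (1 / β) ≤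
            ENNReal.ofReal C₁ *
              essInf (fun x => ENNReal.ofReal (w x)) (volume.restrict (CubeC z r))) →
      ∀ (z : Rn n) (r : ℝ), 0 < r → CubeC z (4 * r) ⊆ Ω →
      ∀ (u : Rn n → ℝ) (L : ℝ≥0), LipschitzOnWith L u (CubeC z r) →
        (∫⁻ x in CubeC z r,
            (ENNReal.ofReal |u x - ⨍ y in CubeC z r, u y|) ^ p * ENNReal.ofReal (w x)) ≤
          ENNReal.ofReal C * ENNReal.ofReal ((2 * r) ^ p) *
            ∫⁻ x in CubeC z r,
              (ENNReal.ofReal ‖fderiv ℝ u x‖) ^ p * ENNReal.ofReal (w x) := by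
  have hn1 : (1 : ℝ) ≤ n := by exact_mod_cast hn
  have hp1 : 1 ≤ p := by
    refine le_trans ?_ hp.le
    rw [le_div_iff₀ (by positivity)]
    linarith
  have hp0 : 0 ≤ p := by linarith
  refine ⟨(2 ^ (n + 1) * n) ^ p * C₁, by positivity, ?_⟩
  intro Ω _ _ _ w hw _ hHarnack z r hr hΩ u L hu
  obtain ⟨v, hv, huv⟩ := hu.extend_real
  set Q := CubeC z r with hQ
  have hQm : MeasurableSet Q := measurableSet_CubeC z r
  have hWm : AEMeasurable (fun x => ENNReal.ofReal (w x)) (volume.restrict Q) := by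
    let k : Set (Rn n) := (WithLp.ofLp : Rn n → (Fin n → ℝ)) ⁻¹'
      (Set.univ.pi fun i => Icc (z i - r) (z i + r))
    have hk : IsCompact k := (PiLp.homeomorph 2 fun _ : Fin n => ℝ).isCompact_preimage.2
      (isCompact_univ_pi fun _ => isCompact_Icc)
    have hkΩ : k ⊆ Ω := fun y hy => hΩ fun i => by
      have h : z i - r ≤ y i ∧ y i ≤ z i + r := hy i (Set.mem_univ i)
      constructor <;> linarith
    have hQk : Q ⊆ k := fun y hy i _ => ⟨(hy i).1, (hy i).2.le⟩
    exact (((hw.integrableOn_compact_subset hkΩ hk).mono_set hQk).aemeasurable).ennreal_ofReal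
  have havg : ⨍ y in Q, u y = ⨍ y in Q, v y := by
    rw [setAverage_eq, setAverage_eq, setIntegral_congr_fun hQm huv]
  calc _ = ∫⁻ x in Q, edist (⨍ y in Q, v y) (v x) ^ p * ENNReal.ofReal (w x) := by
        refine setLIntegral_congr_fun hQm fun x hx => ?_
        simp only [havg, huv hx, edist_dist, dist_comm (⨍ y in Q, v y), Real.dist_eq]
    _ ≤ ENNReal.ofReal (2 ^ (n + 1) * n * (2 * r)) ^ p * (ENNReal.ofReal C₁ *
          ∫⁻ x in Q, ENNReal.ofReal ‖fderiv ℝ v x‖ ^ p * ENNReal.ofReal (w x)) :=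
        lintegral_edist_average_rpow_mul_le hβ hr hWm
          (fun c ρ hρ hc => hHarnack c ρ hρ (hc.trans hΩ)) hv hp1
    _ = ENNReal.ofReal ((2 ^ (n + 1) * n) ^ p * C₁) * ENNReal.ofReal ((2 * r) ^ p) *
          ∫⁻ x in Q, ENNReal.ofReal ‖fderiv ℝ v x‖ ^ p * ENNReal.ofReal (w x) := by
        rw [ENNReal.ofReal_rpow_of_nonneg (by positivity) hp0,
          Real.mul_rpow (by positivity) (by positivity), ENNReal.ofReal_mul (by positivity),
          ENNReal.ofReal_mul (q := C₁) (by positivity)]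
        ring
    _ = _ := by
        congr 1
        refine lintegral_congr_ae ?_
        filter_upwards [ae_mem_interior_CubeC z r] with x hx
        have : u =ᶠ[nhds x] v := by
          filter_upwards [mem_interior_iff_mem_nhds.1 hx] with y hy using huv hy
        rw [this.fderiv_eq]
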